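/- Let U ⊆ ℝ⁴ be open, let g be a smooth map from U to symmetric invertible 4×4 real matrices, F a smooth antisymmetric tensor field F_{μν} on U, β : U → ℝ smooth, and let R^{μν} be any smooth symmetric tensor field on U (in particular the Ricci tensor of g), with scalar R := Σ g_{μν} R^{μν}. Define the Christoffel symbols {α;μν} of g, the covariant Hessian H_{μν} := ∂_μ∂_ν β − Σ_σ {σ;μν} ∂_σ β, β^{μ:ν} := Σ g^{μα} g^{νβ'} H_{αβ'}, □β := Σ g^{μν} H_{μν}, β^μ := Σ g^{μν} ∂_ν β, the Maxwell stress tensor E^{μν} := (1/4) g^{μν} Σ F^{αβ}F_{αβ} − Σ_α F^{μα} F^ν{}_α (indices raised with g^{−1}), the tensor P^{μν} := E^{μν} + β²(2R^{μν} − g^{μν}R) − 4 g^{μν} β □β + 4β β^{μ:ν} + 2 g^{μν} Σ β^σ ∂_σ β − 8 β^μ β^ν, and the scalar S := −2βR − 12 □β. Then the trace identity (D32) holds: Σ g_{μν} P^{μν} = β S. In particular the Maxwell stress tensor is traceless: Σ g_{μν} E^{μν} = 0. -/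

import Mathlib

noncomputable section

/-- Partial derivative within `U` in direction `μ` of a real-valued function on `ℝ⁴`. -/
def pdW (U : Set (Fin 4 → ℝ)) (μ : Fin 4) (f : (Fin 4 → ℝ) → ℝ) (x : Fin 4 → ℝ) : ℝ :=
  fderivWithin ℝ f U x (Pi.single μ 1)

/-- Christoffel symbols `{α;μν}` of the metric `g`, with derivatives taken within `U`. -/
def christoffel (U : Set (Fin 4 → ℝ)) (g : (Fin 4 → ℝ) → Matrix (Fin 4) (Fin 4) ℝ)
    (x : Fin 4 → ℝ) (a b c : Fin 4) : ℝ :=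
  (1 / 2) * ∑ l, (g x)⁻¹ a l *
    (pdW U c (fun y => g y b l) x + pdW U b (fun y => g y l c) x -
      pdW U l (fun y => g y b c) x)

/-- Covariant Hessian `H_{μν} = ∂_μ∂_ν β − Σ_σ {σ;μν} ∂_σ β` of `β`. -/
def hess (U : Set (Fin 4 → ℝ)) (g : (Fin 4 → ℝ) → Matrix (Fin 4) (Fin 4) ℝ)
    (β : (Fin 4 → ℝ) → ℝ) (x : Fin 4 → ℝ) (μ ν : Fin 4) : ℝ :=
  pdW U μ (fun y => pdW U ν β y) x - ∑ σ, christoffel U g x σ μ ν * pdW U σ β x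

/-- Covariant d'Alembertian `□β = Σ g^{μν} H_{μν}`. -/
def boxOp (U : Set (Fin 4 → ℝ)) (g : (Fin 4 → ℝ) → Matrix (Fin 4) (Fin 4) ℝ)
    (β : (Fin 4 → ℝ) → ℝ) (x : Fin 4 → ℝ) : ℝ :=
  ∑ μ, ∑ ν, (g x)⁻¹ μ ν * hess U g β x μ ν

/-- Raised Hessian `β^{μ:ν} = Σ g^{μα} g^{νβ'} H_{αβ'}`. -/
def hessUp (U : Set (Fin 4 → ℝ)) (g : (Fin 4 → ℝ) → Matrix (Fin 4) (Fin 4) ℝ)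
    (β : (Fin 4 → ℝ) → ℝ) (x : Fin 4 → ℝ) (μ ν : Fin 4) : ℝ :=
  ∑ a, ∑ b, (g x)⁻¹ μ a * (g x)⁻¹ ν b * hess U g β x a b

/-- Raised gradient `β^μ = Σ g^{μν} ∂_ν β`. -/
def gradUp (U : Set (Fin 4 → ℝ)) (g : (Fin 4 → ℝ) → Matrix (Fin 4) (Fin 4) ℝ)
    (β : (Fin 4 → ℝ) → ℝ) (x : Fin 4 → ℝ) (μ : Fin 4) : ℝ :=
  ∑ ν, (g x)⁻¹ μ ν * pdW U ν β x

/-- Raised field strength `F^{αβ} = Σ g^{αa} g^{βb} F_{ab}`. -/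
def fUp (g : (Fin 4 → ℝ) → Matrix (Fin 4) (Fin 4) ℝ)
    (F : (Fin 4 → ℝ) → Fin 4 → Fin 4 → ℝ) (x : Fin 4 → ℝ) (α β : Fin 4) : ℝ :=
  ∑ a, ∑ b, (g x)⁻¹ α a * (g x)⁻¹ β b * F x a b

/-- Maxwell stress tensor `E^{μν} = (1/4) g^{μν} F^{αβ}F_{αβ} − Σ_α F^{μα} F^ν{}_α`. -/
def maxwellE (g : (Fin 4 → ℝ) → Matrix (Fin 4) (Fin 4) ℝ)
    (F : (Fin 4 → ℝ) → Fin 4 → Fin 4 → ℝ) (x : Fin 4 → ℝ) (μ ν : Fin 4) : ℝ :=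
  (1 / 4) * (g x)⁻¹ μ ν * (∑ α, ∑ β, fUp g F x α β * F x α β) -
    ∑ α, fUp g F x μ α * (∑ b, (g x)⁻¹ ν b * F x b α)

/-- Scalar `R = Σ g_{μν} R^{μν}` of a symmetric tensor `R^{μν}`. -/
def rScal (g : (Fin 4 → ℝ) → Matrix (Fin 4) (Fin 4) ℝ)
    (Rup : (Fin 4 → ℝ) → Fin 4 → Fin 4 → ℝ) (x : Fin 4 → ℝ) : ℝ :=
  ∑ μ, ∑ ν, g x μ ν * Rup x μ ν

/-- The Weyl–Dirac field tensor `P^{μν}` of (5.7). -/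
def pField (U : Set (Fin 4 → ℝ)) (g : (Fin 4 → ℝ) → Matrix (Fin 4) (Fin 4) ℝ)
    (F : (Fin 4 → ℝ) → Fin 4 → Fin 4 → ℝ) (β : (Fin 4 → ℝ) → ℝ)
    (Rup : (Fin 4 → ℝ) → Fin 4 → Fin 4 → ℝ) (x : Fin 4 → ℝ) (μ ν : Fin 4) : ℝ :=
  maxwellE g F x μ ν +
    (β x) ^ 2 * (2 * Rup x μ ν - (g x)⁻¹ μ ν * rScal g Rup x) -
    4 * (g x)⁻¹ μ ν * β x * boxOp U g β x +
    4 * β x * hessUp U g β x μ ν +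
    2 * (g x)⁻¹ μ ν * (∑ σ, gradUp U g β x σ * pdW U σ β x) -
    8 * gradUp U g β x μ * gradUp U g β x ν

/-- The Weyl–Dirac scalar `S = −2βR − 12□β` of (5.7). -/
def sField (U : Set (Fin 4 → ℝ)) (g : (Fin 4 → ℝ) → Matrix (Fin 4) (Fin 4) ℝ)
    (β : (Fin 4 → ℝ) → ℝ) (Rup : (Fin 4 → ℝ) → Fin 4 → Fin 4 → ℝ)
    (x : Fin 4 → ℝ) : ℝ :=
  -2 * β x * rScal g Rup x - 12 * boxOp U g β x

/-- Lowering an index after raising it recovers the original components. -/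
theorem sum_mul_sum_inv_mul {n : Type*} [Fintype n] [DecidableEq n] (G : Matrix n n ℝ)
    (h : IsUnit G.det) (v : n → ℝ) (i : n) :
    ∑ j, G i j * ∑ k, G⁻¹ j k * v k = v i := by
  have key : G.mulVec (G⁻¹.mulVec v) = v := by
    rw [Matrix.mulVec_mulVec, Matrix.mul_nonsing_inv G h, Matrix.one_mulVec]
  simpa [Matrix.mulVec, dotProduct] using congrFun key i

/-- Contracting `X^i v^j` with the metric gives the pairing of `X` with `v`. -/
theorem sum_sum_mul_mul_sum_inv_mul {n : Type*} [Fintype n] [DecidableEq n] (G : Matrix n n ℝ)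
    (h : IsUnit G.det) (X v : n → ℝ) :
    ∑ i, ∑ j, G i j * (X i * ∑ k, G⁻¹ j k * v k) = ∑ i, X i * v i := by
  refine Finset.sum_congr rfl fun i _ => ?_
  rw [← sum_mul_sum_inv_mul G h v i, Finset.mul_sum]
  exact Finset.sum_congr rfl fun j _ => by ring

/-- The inverse of a symmetric matrix is symmetric. -/
theorem inv_apply_comm {n : Type*} [Fintype n] [DecidableEq n] (G : Matrix n n ℝ)
    (hs : ∀ i j, G i j = G j i) (i j : n) : G⁻¹ i j = G⁻¹ j i := by
  have hG : G.IsSymm := Matrix.IsSymm.ext fun i j => hs j i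
  have key : G⁻¹.transpose = G⁻¹ := by rw [Matrix.transpose_nonsing_inv, hG.eq]
  exact congrFun (congrFun key j) i

/-- The full contraction of a metric with its inverse is the dimension. -/
theorem sum_sum_mul_inv {n : Type*} [Fintype n] [DecidableEq n] (G : Matrix n n ℝ)
    (h : IsUnit G.det) (hs : ∀ i j, G i j = G j i) :
    ∑ i, ∑ j, G i j * G⁻¹ i j = Fintype.card n := by
  have key : Matrix.trace (G * G⁻¹) = Fintype.card n := by
    rw [Matrix.mul_nonsing_inv G h, Matrix.trace_one]
  rw [← key]
  simp only [Matrix.trace, Matrix.diag, Matrix.mul_apply]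
  exact Finset.sum_congr rfl fun i _ => Finset.sum_congr rfl fun j _ => by
    rw [inv_apply_comm G hs i j]

/-- The Maxwell stress tensor is traceless. -/
theorem sum_sum_mul_maxwellE (g : (Fin 4 → ℝ) → Matrix (Fin 4) (Fin 4) ℝ)
    (F : (Fin 4 → ℝ) → Fin 4 → Fin 4 → ℝ) (x : Fin 4 → ℝ)
    (h : IsUnit (g x).det) (hs : ∀ i j, g x i j = g x j i) :
    ∑ μ, ∑ ν, g x μ ν * maxwellE g F x μ ν = 0 := by
  have h4 := sum_sum_mul_inv (g x) h hs
  set K := ∑ α, ∑ β, fUp g F x α β * F x α β with hK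
  have hF : ∑ μ, ∑ ν, g x μ ν * ∑ α, fUp g F x μ α * (∑ b, (g x)⁻¹ ν b * F x b α) = K := by
    refine Finset.sum_congr rfl fun μ _ => ?_
    simp only [Finset.mul_sum _ (fun α => fUp g F x μ α * _)]
    rw [Finset.sum_comm]
    refine Finset.sum_congr rfl fun α _ => ?_
    rw [← sum_mul_sum_inv_mul (g x) h (fun b => F x b α) μ, Finset.mul_sum]
    exact Finset.sum_congr rfl fun ν _ => by ring
  have hterm : ∀ μ ν, g x μ ν * maxwellE g F x μ ν =
      (1 / 4) * K * (g x μ ν * (g x)⁻¹ μ ν) -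
        g x μ ν * ∑ α, fUp g F x μ α * (∑ b, (g x)⁻¹ ν b * F x b α) := by
    intro μ ν
    rw [maxwellE, ← hK]
    ring
  simp only [hterm, Finset.sum_sub_distrib]
  rw [hF]
  simp only [← Finset.mul_sum]
  rw [h4, Fintype.card_fin]
  push_cast
  ring

/-- The trace of the raised Hessian is the box operator. -/
theorem sum_sum_mul_hessUp (U : Set (Fin 4 → ℝ)) (g : (Fin 4 → ℝ) → Matrix (Fin 4) (Fin 4) ℝ)
    (β : (Fin 4 → ℝ) → ℝ) (x : Fin 4 → ℝ)
    (h : IsUnit (g x).det) (hs : ∀ i j, g x i j = g x j i) :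
    ∑ μ, ∑ ν, g x μ ν * hessUp U g β x μ ν = boxOp U g β x := by
  have hlow : ∀ μ ν, hessUp U g β x μ ν =
      ∑ b, (g x)⁻¹ ν b * ∑ a, (g x)⁻¹ μ a * hess U g β x a b := by
    intro μ ν
    rw [hessUp, Finset.sum_comm]
    refine Finset.sum_congr rfl fun b _ => ?_
    rw [Finset.mul_sum]
    exact Finset.sum_congr rfl fun a _ => by ring
  simp only [hlow]
  rw [Finset.sum_congr rfl fun μ _ => sum_mul_sum_inv_mul (g x) h
    (fun b => ∑ a, (g x)⁻¹ μ a * hess U g β x a b) μ, boxOp, Finset.sum_comm]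
  exact Finset.sum_congr rfl fun a _ => Finset.sum_congr rfl fun b _ => by
    rw [inv_apply_comm (g x) hs]

/-- The trace identity (D32) of the Weyl–Dirac theory: `Σ g_{μν} P^{μν} = β S`; in
particular the Maxwell stress tensor is traceless: `Σ g_{μν} E^{μν} = 0`. -/
theorem weyl_dirac_trace_identity
    (U : Set (Fin 4 → ℝ)) (hU : IsOpen U)
    (g : (Fin 4 → ℝ) → Matrix (Fin 4) (Fin 4) ℝ)
    (hg : ∀ i j, ContDiffOn ℝ (⊤ : ℕ∞) (fun x => g x i j) U)
    (hsym : ∀ x ∈ U, ∀ i j, g x i j = g x j i)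
    (hinv : ∀ x ∈ U, IsUnit (g x).det)
    (F : (Fin 4 → ℝ) → Fin 4 → Fin 4 → ℝ)
    (hF : ∀ i j, ContDiffOn ℝ (⊤ : ℕ∞) (fun x => F x i j) U)
    (hFanti : ∀ x ∈ U, ∀ i j, F x i j = -F x j i)
    (β : (Fin 4 → ℝ) → ℝ) (hβ : ContDiffOn ℝ (⊤ : ℕ∞) β U)
    (Rup : (Fin 4 → ℝ) → Fin 4 → Fin 4 → ℝ)
    (hRup : ∀ i j, ContDiffOn ℝ (⊤ : ℕ∞) (fun x => Rup x i j) U)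
    (hRsym : ∀ x ∈ U, ∀ i j, Rup x i j = Rup x j i) :
    ∀ x ∈ U,
      (∑ μ, ∑ ν, g x μ ν * pField U g F β Rup x μ ν) = β x * sField U g β Rup x ∧
      (∑ μ, ∑ ν, g x μ ν * maxwellE g F x μ ν) = 0 := by
  intro x hx
  have h := hinv x hx
  have hs := hsym x hx
  have hE := sum_sum_mul_maxwellE g F x h hs
  refine ⟨?_, hE⟩
  have h4 := sum_sum_mul_inv (g x) h hs
  have hH := sum_sum_mul_hessUp U g β x h hs
  have hG : ∑ μ, ∑ ν, g x μ ν * (gradUp U g β x μ * gradUp U g β x ν) =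
      ∑ σ, gradUp U g β x σ * pdW U σ β x :=
    sum_sum_mul_mul_sum_inv_mul (g x) h (gradUp U g β x) (fun σ => pdW U σ β x)
  set N := ∑ σ, gradUp U g β x σ * pdW U σ β x with hN
  have hterm : ∀ μ ν, g x μ ν * pField U g F β Rup x μ ν =
      g x μ ν * maxwellE g F x μ ν + 2 * β x ^ 2 * (g x μ ν * Rup x μ ν) +
      (2 * N - β x ^ 2 * rScal g Rup x - 4 * β x * boxOp U g β x) *
        (g x μ ν * (g x)⁻¹ μ ν) +
      4 * β x * (g x μ ν * hessUp U g β x μ ν) -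
      8 * (g x μ ν * (gradUp U g β x μ * gradUp U g β x ν)) := by
    intro μ ν
    rw [pField, ← hN]
    ring
  simp only [hterm, Finset.sum_add_distrib, Finset.sum_sub_distrib, ← Finset.mul_sum]
  rw [hE, h4, hH, hG, Fintype.card_fin, sField, ← rScal]
  push_cast
  ring
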